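/- arXiv:2011.05417 — 6 statements merged into one kernel-verified Lean document; each statement's English description precedes it below -/
import Mathlib

section
/- Let λ ∈ ℝ^n with λ_1 > λ_2 > ⋯ > λ_n, and let q be a positive integer such that λ_i = p_i/q for some integers p_1, …, p_n. Then there exists P* ∈ GT(λ) such that every triangular array R with top row λ and |R_{i,j} − P*_{i,j}| ≤ 1/(8 n² q) for all 1 ≤ i ≤ j ≤ n−1 belongs to GT(λ); in particular GT(λ) ⊆ ℝ^{n(n−1)/2} contains a Euclidean ball of radius 1/(8 n² q). -/
open MeasureTheory

/-- Index set for the free coordinates of a Gelfand–Tsetlin pattern of size `n`: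
pairs `(i, j)` (0-based) with `i ≤ j` and `j + 1 < n`, corresponding to the entry `R_{i+1, j+1}`
(1-based) lying in one of the first `n - 1` rows.  There are `n (n - 1) / 2` such coordinates. -/
def TriIdx (n : ℕ) : Type :=
  {p : Fin n × Fin n // p.1 ≤ p.2 ∧ (p.2 : ℕ) + 1 < n}

instance (n : ℕ) : Fintype (TriIdx n) := by unfold TriIdx; infer_instance

/-- The entry `R_{a+1, b+1}` (1-based: row `b+1`, position `a+1`) of the triangular array
determined by the free coordinates `R : TriIdx n → ℝ` together with the fixed top row `lam`. -/
noncomputable def gtEntry (n : ℕ) (lam : Fin n → ℝ) (R : TriIdx n → ℝ) (a b : ℕ) : ℝ :=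
  if h : a ≤ b ∧ b < n then
    if h2 : b + 1 < n then
      R ⟨(⟨a, lt_of_le_of_lt h.1 h.2⟩, ⟨b, h.2⟩), ⟨h.1, h2⟩⟩
    else lam ⟨a, lt_of_le_of_lt h.1 h.2⟩
  else 0

/-- The Gelfand–Tsetlin polytope `GT(lam)`, viewed as the subset of `ℝ^{n(n-1)/2}` of free
coordinates (the top row being fixed equal to `lam`) cut out by the interlacing inequalities
`R_{i,j} ≥ R_{i,j-1} ≥ R_{i+1,j}` for `1 ≤ i < j ≤ n`. -/
noncomputable def gtSet (n : ℕ) (lam : Fin n → ℝ) : Set (TriIdx n → ℝ) :=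
  {R | ∀ a b : ℕ, a ≤ b → b + 1 < n →
    gtEntry n lam R a b ≤ gtEntry n lam R a (b + 1) ∧
    gtEntry n lam R (a + 1) (b + 1) ≤ gtEntry n lam R a b}


/-- The center of the inner ball: row `b` is the beginning of the top row, shifted down by
`(n - 1 - b) / (n q)`. -/
noncomputable def gtCenter (n : ℕ) (lam : Fin n → ℝ) (q : ℕ) (t : TriIdx n) : ℝ :=
  lam t.1.1 - ((n : ℝ) - 1 - ((t.1.2 : ℕ) : ℝ)) / ((n : ℝ) * q)

theorem gtEntry_gtCenter {n : ℕ} (lam : Fin n → ℝ) (q : ℕ) {a b : ℕ} (hab : a ≤ b)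
    (hb : b < n) :
    gtEntry n lam (gtCenter n lam q) a b =
      lam ⟨a, hab.trans_lt hb⟩ - ((n : ℝ) - 1 - b) / ((n : ℝ) * q) := by
  unfold gtEntry
  rw [dif_pos ⟨hab, hb⟩]
  split_ifs with h
  · rfl
  · have hn : (n : ℝ) = b + 1 := by
      exact_mod_cast (show n = b + 1 by omega)
    simp [hn]

theorem abs_gtEntry_sub_le {n : ℕ} (lam : Fin n → ℝ) {R S : TriIdx n → ℝ} {ε : ℝ} (hε : 0 ≤ ε)
    (h : ∀ t, |R t - S t| ≤ ε) (a b : ℕ) :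
    |gtEntry n lam R a b - gtEntry n lam S a b| ≤ ε := by
  unfold gtEntry
  split_ifs
  · exact h _
  all_goals simpa using hε

theorem add_one_div_le_of_strictAnti {n : ℕ} {lam : Fin n → ℝ} (hlam : StrictAnti lam)
    {q : ℕ} (hq : 0 < q) {p : Fin n → ℤ} (hlamq : ∀ i, lam i = (p i : ℝ) / (q : ℝ))
    {i j : Fin n} (hij : i < j) : lam j + 1 / (q : ℝ) ≤ lam i := by
  have hq' : (0 : ℝ) < q := by exact_mod_cast hq
  have h := hlam hij
  rw [hlamq, hlamq, div_lt_div_iff_of_pos_right hq'] at h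
  have h' : p j + 1 ≤ p i := by exact_mod_cast h
  rw [hlamq, hlamq, ← add_div, div_le_div_iff_of_pos_right hq']
  exact_mod_cast h'

theorem mem_gtSet_of_abs_sub_gtCenter_le {n : ℕ} {lam : Fin n → ℝ} (hlam : StrictAnti lam)
    {q : ℕ} (hq : 0 < q) {p : Fin n → ℤ} (hlamq : ∀ i, lam i = (p i : ℝ) / (q : ℝ))
    {R : TriIdx n → ℝ}
    (hR : ∀ t, |R t - gtCenter n lam q t| ≤ 1 / (8 * (n : ℝ) ^ 2 * (q : ℝ))) :
    R ∈ gtSet n lam := by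
  intro a b hab hb
  have hq' : (0 : ℝ) < q := by exact_mod_cast hq
  have hn : (2 : ℝ) ≤ n := by exact_mod_cast (show 2 ≤ n by omega)
  have hclose := abs_gtEntry_sub_le lam (by positivity) hR
  have h₀ := abs_le.1 (hclose a b)
  have h₁ := abs_le.1 (hclose a (b + 1))
  have h₂ := abs_le.1 (hclose (a + 1) (b + 1))
  rw [gtEntry_gtCenter lam q hab (by omega)] at h₀
  rw [gtEntry_gtCenter lam q (by omega) hb] at h₁ h₂
  have hgap := add_one_div_le_of_strictAnti hlam hq hlamq
    (show (⟨a, by omega⟩ : Fin n) < ⟨a + 1, by omega⟩ from Nat.lt_succ_self a)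
  have hstep : ((n : ℝ) - 1 - b) / (n * q) =
      ((n : ℝ) - 1 - (b + 1 : ℕ)) / (n * q) + 1 / (n * q) := by
    push_cast
    ring
  have hε : 2 * (1 / (8 * (n : ℝ) ^ 2 * q)) ≤ 1 / (n * q) := by
    rw [mul_one_div, div_le_div_iff₀ (by positivity) (by positivity)]
    nlinarith [mul_nonneg (mul_nonneg (by positivity : (0 : ℝ) ≤ n) hq'.le)
      (by linarith : (0 : ℝ) ≤ n - 2), mul_pos (by positivity : (0 : ℝ) < n) hq']
  have hδ : 2 * (1 / ((n : ℝ) * q)) ≤ 1 / q := by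
    rw [mul_one_div, div_le_div_iff₀ (by positivity) hq']
    nlinarith
  constructor <;> linarith

/-- **Inner ball for the Gelfand–Tsetlin polytope.**
Let `lam : Fin n → ℝ` be strictly decreasing, and let `q > 0` be an integer such that each
`lam i = pᵢ / q` for some integers `pᵢ`.  Then there exists `Pstar ∈ GT(lam)` such that every
triangular array `R` (with top row `lam`) satisfying `|R t − Pstar t| ≤ 1/(8 n² q)` in every
free coordinate `t` belongs to `GT(lam)`; in particular (since the Euclidean ball is contained
in the `ℓ^∞` ball) `GT(lam) ⊆ ℝ^{n(n-1)/2}` contains a Euclidean ball of radius `1/(8 n² q)`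
centered at `Pstar`. -/
theorem gt_inner_ball (n : ℕ) (lam : Fin n → ℝ) (hlam : StrictAnti lam)
    (q : ℕ) (hq : 0 < q) (p : Fin n → ℤ) (hlamq : ∀ i, lam i = (p i : ℝ) / (q : ℝ)) :
    ∃ Pstar ∈ gtSet n lam,
      (∀ R : TriIdx n → ℝ,
        (∀ t : TriIdx n, |R t - Pstar t| ≤ 1 / (8 * (n : ℝ) ^ 2 * (q : ℝ))) →
        R ∈ gtSet n lam) ∧
      (∀ R : TriIdx n → ℝ,
        Real.sqrt (∑ t : TriIdx n, (R t - Pstar t) ^ 2) ≤ 1 / (8 * (n : ℝ) ^ 2 * (q : ℝ)) →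
        R ∈ gtSet n lam) := by
  have hball : ∀ R : TriIdx n → ℝ,
      (∀ t, |R t - gtCenter n lam q t| ≤ 1 / (8 * (n : ℝ) ^ 2 * (q : ℝ))) → R ∈ gtSet n lam :=
    fun R hR => mem_gtSet_of_abs_sub_gtCenter_le hlam hq hlamq hR
  refine ⟨gtCenter n lam q, hball _ fun t => ?_, hball, fun R hR => hball R fun t => ?_⟩
  · rw [sub_self, abs_zero]
    positivity
  · refine le_trans (Real.abs_le_sqrt ?_) hR
    exact Finset.single_le_sum (f := fun t => (R t - gtCenter n lam q t) ^ 2)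
      (fun _ _ => sq_nonneg _) (Finset.mem_univ t)
end

section
/- For all v ∈ ℂ^{k−1} and c ∈ ℝ, the characteristic polynomial of M(v,c) satisfies det(t I − M(v,c)) = (t − c) ∏_{j=1}^m (t − δ_j)^{n_j} − Σ_{i=1}^m s_i(v) · (t − δ_i)^{n_i − 1} ∏_{j ≠ i} (t − δ_j)^{n_j}, as an identity of polynomials in t. -/
open Polynomial

/-- The `k × k` Hermitian matrix `[[D, v], [v*, c]]` where `D` is the `(k-1) × (k-1)` real
diagonal matrix with diagonal `d`, bordered by the vector `v ∈ ℂ^{k-1}` and the real scalar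
`c` (the index type `Fin (k-1) ⊕ Unit` has `k` elements). -/
noncomputable def borderedMatrix {r : ℕ} (d : Fin r → ℝ) (v : Fin r → ℂ) (c : ℝ) :
    Matrix (Fin r ⊕ Unit) (Fin r ⊕ Unit) ℂ :=
  Matrix.fromBlocks (Matrix.diagonal fun l => (d l : ℂ))
    (Matrix.of fun l (_ : Unit) => v l)
    (Matrix.of fun (_ : Unit) l => (starRingEnd ℂ) (v l))
    (Matrix.of fun _ _ => (c : ℂ))

/-- Determinant of a diagonal matrix bordered by one column and one row. -/
theorem det_fromBlocks_diagonal_border {ι R : Type*} [Fintype ι] [DecidableEq ι] [CommRing R]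
    [IsDomain R] (a b b' : ι → R) (e : R) (ha : ∀ l, a l ≠ 0) :
    (Matrix.fromBlocks (Matrix.diagonal a) (Matrix.of fun l (_ : Unit) => b l)
      (Matrix.of fun (_ : Unit) l => b' l) (Matrix.of fun _ _ => e)).det
      = e * ∏ l, a l - ∑ l, b l * b' l * ∏ j ∈ Finset.univ.erase l, a j := by
  have hP : ∏ l, a l ≠ 0 := Finset.prod_ne_zero_iff.mpr fun l _ => ha l
  have key : Matrix.fromBlocks (Matrix.diagonal a) (Matrix.of fun l (_ : Unit) => b l)
        (Matrix.of fun (_ : Unit) l => b' l) (Matrix.of fun _ _ => e)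
      * Matrix.fromBlocks 1
          (Matrix.of fun l (_ : Unit) => -((∏ j ∈ Finset.univ.erase l, a j) * b l))
          0 (Matrix.of fun _ _ => ∏ l, a l)
      = Matrix.fromBlocks (Matrix.diagonal a) 0 (Matrix.of fun (_ : Unit) l => b' l)
          (Matrix.of fun _ _ =>
            e * ∏ l, a l - ∑ l, b l * b' l * ∏ j ∈ Finset.univ.erase l, a j) := by
    rw [Matrix.fromBlocks_multiply]
    congr 1
    · simp
    · ext l u
      rw [Matrix.add_apply, Matrix.diagonal_mul]
      simp only [Matrix.of_apply, Matrix.mul_apply,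
        Finset.univ_unique, Finset.sum_singleton, Matrix.zero_apply]
      rw [← Finset.mul_prod_erase Finset.univ a (Finset.mem_univ l)]
      ring
    · simp
    · ext u u'
      simp only [Matrix.add_apply, Matrix.of_apply, Matrix.mul_apply,
        Finset.univ_unique, Finset.sum_singleton]
      rw [add_comm, sub_eq_add_neg, ← Finset.sum_neg_distrib]
      congr 1
      exact Finset.sum_congr rfl fun l _ => by ring
  have hdet := congrArg Matrix.det key
  rw [Matrix.det_mul, Matrix.det_fromBlocks_zero₂₁, Matrix.det_fromBlocks_zero₁₂,
    Matrix.det_one, Matrix.det_diagonal, Matrix.det_unique (n := Unit),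
    Matrix.det_unique (n := Unit), one_mul,
    Matrix.of_apply, Matrix.of_apply, mul_comm] at hdet
  exact mul_left_cancel₀ hP hdet

/-- Removing one index `l` from a product that factors through `f` lowers the exponent of the
factor attached to `f l` by one. -/
theorem prod_erase_comp_eq_pow_mul_prod_erase {ι κ R : Type*} [Fintype ι] [DecidableEq ι]
    [Fintype κ] [DecidableEq κ] [CommMonoid R] (f : ι → κ) (g : κ → R) (l : ι) :
    ∏ j ∈ Finset.univ.erase l, g (f j)
      = g (f l) ^ ((Finset.univ.filter fun j => f j = f l).card - 1) *
          ∏ i ∈ Finset.univ.erase (f l), g i ^ (Finset.univ.filter fun j => f j = i).card := by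
  rw [← Finset.prod_fiberwise' (Finset.univ.erase l) f g,
    ← Finset.mul_prod_erase Finset.univ _ (Finset.mem_univ (f l))]
  simp only [Finset.prod_const]
  congr 1
  · rw [Finset.filter_erase, Finset.card_erase_of_mem (by simp)]
  · refine Finset.prod_congr rfl fun i hi => ?_
    rw [Finset.filter_erase, Finset.erase_eq_of_notMem]
    simpa using (Finset.ne_of_mem_erase hi).symm

/-- The characteristic polynomial of a bordered diagonal matrix, with one summand for each
diagonal entry. -/
theorem charpoly_borderedMatrix {r : ℕ} (d : Fin r → ℝ) (v : Fin r → ℂ) (c : ℝ) :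
    (borderedMatrix d v c).charpoly
      = (X - C (c : ℂ)) * ∏ l, (X - C (d l : ℂ))
        - ∑ l, C (Complex.normSq (v l) : ℂ) *
            ∏ j ∈ Finset.univ.erase l, (X - C (d j : ℂ)) := by
  have hchar : (borderedMatrix d v c).charmatrix
      = Matrix.fromBlocks (Matrix.diagonal fun l => X - C (d l : ℂ))
          (Matrix.of fun l (_ : Unit) => -C (v l))
          (Matrix.of fun (_ : Unit) l => -C ((starRingEnd ℂ) (v l)))
          (Matrix.of fun _ _ => X - C (c : ℂ)) := by
    rw [borderedMatrix, Matrix.charmatrix_fromBlocks, Matrix.charmatrix_diagonal]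
    congr 1
  rw [Matrix.charpoly, hchar, det_fromBlocks_diagonal_border _ _ _ _ fun l => X_sub_C_ne_zero _]
  simp only [neg_mul_neg, ← C_mul, Complex.mul_conj]

/-- **Characteristic polynomial of a bordered diagonal matrix.**
Let `k ≥ 2`, `m ≥ 1`, `δ 0 > δ 1 > ⋯ > δ (m-1)` real numbers, and let
`blk : Fin (k-1) → Fin m` be a monotone surjection, so that the positions in the `i`-th block
are the fiber `blk⁻¹ {i}`, of cardinality `nᵢ ≥ 1` with `n₀ + ⋯ + n_{m-1} = k - 1`.  Let `D` be
the `(k-1) × (k-1)` diagonal matrix whose diagonal lists `δ 0` repeated `n₀` times, then `δ 1`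
repeated `n₁` times, and so on (i.e. with diagonal `δ ∘ blk`), and for `v ∈ ℂ^{k-1}` let
`sᵢ(v)` be the squared norm of the `i`-th block of `v`.  Then for all `v` and `c : ℝ`, the
matrix `M(v, c) = [[D, v], [v*, c]]` satisfies
`det (t I − M(v,c)) = (t − c) ∏ⱼ (t − δⱼ)^{nⱼ} − Σᵢ sᵢ(v) (t − δᵢ)^{nᵢ − 1} ∏_{j ≠ i} (t − δⱼ)^{nⱼ}`
as an identity of polynomials in `t`. -/
theorem charpoly_bordered_diagonal (k m : ℕ) (hk : 2 ≤ k) (hm : 1 ≤ m)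
    (δ : Fin m → ℝ) (hδ : StrictAnti δ)
    (blk : Fin (k - 1) → Fin m) (hmono : Monotone blk) (hsurj : Function.Surjective blk)
    (v : Fin (k - 1) → ℂ) (c : ℝ) :
    (borderedMatrix (fun l => δ (blk l)) v c).charpoly
      = (X - C (c : ℂ)) *
          (∏ j : Fin m, (X - C ((δ j : ℝ) : ℂ)) ^ (Finset.univ.filter fun l => blk l = j).card)
        - ∑ i : Fin m,
            C (((∑ l ∈ Finset.univ.filter fun l => blk l = i, Complex.normSq (v l) : ℝ)) : ℂ) *
              ((X - C ((δ i : ℝ) : ℂ)) ^ ((Finset.univ.filter fun l => blk l = i).card - 1) *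
                ∏ j ∈ Finset.univ.erase i,
                  (X - C ((δ j : ℝ) : ℂ)) ^ (Finset.univ.filter fun l => blk l = j).card) := by
  rw [charpoly_borderedMatrix]
  congr 1
  · rw [← Finset.prod_fiberwise' Finset.univ blk fun j => X - C ((δ j : ℝ) : ℂ)]
    simp only [Finset.prod_const]
  · rw [← Finset.sum_fiberwise Finset.univ blk]
    refine Finset.sum_congr rfl fun i _ => ?_
    rw [Complex.ofReal_sum, map_sum, Finset.sum_mul]
    refine Finset.sum_congr rfl fun l hl => ?_
    obtain rfl : blk l = i := (Finset.mem_filter.mp hl).2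
    rw [prod_erase_comp_eq_pow_mul_prod_erase blk fun j => X - C ((δ j : ℝ) : ℂ)]
end

section
/- Let μ_1, …, μ_{m+1} be real numbers satisfying the interlacing relations μ_1 ≥ δ_1 ≥ μ_2 ≥ δ_2 ≥ ⋯ ≥ δ_m ≥ μ_{m+1}, set c = Σ_{i=1}^{m+1} μ_i − Σ_{j=1}^m δ_j, and define r_i² = − ∏_{j=1}^{m+1} (δ_i − μ_j) / ∏_{j ≠ i} (δ_i − δ_j) for i = 1, …, m. Then for v ∈ ℂ^{k−1}, the matrix M(v,c) has characteristic polynomial det(t I − M(v,c)) = ∏_{i=1}^{m+1} (t − μ_i) · ∏_{j=1}^m (t − δ_j)^{n_j − 1} if and only if s_i(v) = r_i² for every i = 1, …, m. -/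
open Polynomial

namespace Polynomial

theorem degree_sub_lt_of_nextCoeff_eq {R : Type*} [CommRing R] [Nontrivial R] {p q : R[X]} {n : ℕ}
    (hp : p.Monic) (hq : q.Monic) (hpn : p.natDegree = n + 1) (hqn : q.natDegree = n + 1)
    (h : p.nextCoeff = q.nextCoeff) : (p - q).degree < n := by
  rw [degree_lt_iff_coeff_zero]
  intro j hj
  rw [coeff_sub, sub_eq_zero]
  rcases hj.eq_or_lt with rfl | hj
  · simpa [nextCoeff_of_natDegree_pos, hpn, hqn] using h
  rcases (Nat.succ_le_of_lt hj).eq_or_lt with rfl | hj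
  · have hp' := hp.coeff_natDegree
    have hq' := hq.coeff_natDegree
    rw [hpn] at hp'
    rw [hqn] at hq'
    exact hp'.trans hq'.symm
  · rw [coeff_eq_zero_of_natDegree_lt (by omega), coeff_eq_zero_of_natDegree_lt (by omega)]

end Polynomial

open Finset in
/-- The characteristic polynomial of a diagonal matrix bordered by one row and one column. -/
theorem Matrix.charpoly_fromBlocks_diagonal_unit {K ι : Type*} [Field K] [Infinite K] [Fintype ι]
    [DecidableEq ι] (d v w : ι → K) (c : K) :
    (Matrix.fromBlocks (Matrix.diagonal d) (Matrix.of fun l (_ : Unit) => v l)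
      (Matrix.of fun (_ : Unit) l => w l) (Matrix.of fun _ _ => c)).charpoly
      = (X - C c) * ∏ l, (X - C (d l))
        - ∑ l, C (v l * w l) * ∏ l' ∈ univ.erase l, (X - C (d l')) := by
  refine Polynomial.eq_of_infinite_eval_eq _ _
    ((Set.finite_range d).infinite_compl.mono fun t ht => ?_)
  have hne : ∀ l, t - d l ≠ 0 := fun l h => ht ⟨l, (sub_eq_zero.mp h).symm⟩
  have hmul : Matrix.diagonal (fun l => t - d l) * Matrix.diagonal (fun l => (t - d l)⁻¹) = 1 := by
    simp [hne]
  let _ : Invertible (Matrix.diagonal fun l => t - d l) :=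
    ⟨_, mul_eq_one_comm.mp hmul, hmul⟩
  have hinv : ⅟(Matrix.diagonal fun l => t - d l) = Matrix.diagonal fun l => (t - d l)⁻¹ :=
    invOf_eq_right_inv hmul
  have hblocks : Matrix.scalar (ι ⊕ Unit) t -
      Matrix.fromBlocks (Matrix.diagonal d) (Matrix.of fun l (_ : Unit) => v l)
        (Matrix.of fun (_ : Unit) l => w l) (Matrix.of fun _ _ => c)
      = Matrix.fromBlocks (Matrix.diagonal fun l => t - d l) (Matrix.of fun l (_ : Unit) => -v l)
        (Matrix.of fun (_ : Unit) l => -w l) (Matrix.of fun _ _ => t - c) := by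
    ext (i | i) (j | j) <;> simp [Matrix.diagonal_apply]
    split_ifs <;> simp
  rw [Set.mem_ofPred_eq, Matrix.eval_charpoly, hblocks, Matrix.det_fromBlocks₁₁, hinv,
    Matrix.det_diagonal, Matrix.det_unique, Matrix.sub_apply, Matrix.mul_apply]
  simp only [Matrix.mul_diagonal, Matrix.of_apply, eval_sub,
    eval_mul, eval_X, eval_C, eval_prod, eval_finsetSum]
  rw [mul_sub, mul_comm, mul_sum]
  congr 1
  refine sum_congr rfl fun l _ => ?_
  rw [← mul_prod_erase univ _ (mem_univ l)]
  field_simp [hne l]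

section Fiber

open Finset

variable {ι κ : Type*} [Fintype ι] [Fintype κ] [DecidableEq κ]

theorem Finset.prod_comp_eq_prod_pow_card_sub_one_mul {M : Type*} [CommMonoid M] {b : ι → κ}
    (hb : Function.Surjective b) (f : κ → M) :
    ∏ l, f (b l) = (∏ j, f j ^ (#{l | b l = j} - 1)) * ∏ j, f j := by
  rw [← prod_mul_distrib, ← prod_fiberwise' univ b f]
  refine prod_congr rfl fun j _ => ?_
  obtain ⟨l, hl⟩ := hb j
  rw [prod_const, ← pow_succ, Nat.sub_add_cancel (card_pos.mpr ⟨l, by simpa using hl⟩)]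

theorem Finset.prod_erase_comp_eq_prod_pow_card_sub_one_mul {M : Type*} [CommMonoidWithZero M]
    [IsLeftCancelMulZero M] [DecidableEq ι] {b : ι → κ} (hb : Function.Surjective b)
    {f : κ → M} (hf : ∀ j, f j ≠ 0) (l : ι) :
    ∏ l' ∈ univ.erase l, f (b l')
      = (∏ j, f j ^ (#{l | b l = j} - 1)) * ∏ j ∈ univ.erase (b l), f j := by
  refine mul_left_cancel₀ (hf (b l)) ?_
  rw [mul_prod_erase univ (fun l => f (b l)) (mem_univ l), mul_left_comm,
    mul_prod_erase univ f (mem_univ (b l)), prod_comp_eq_prod_pow_card_sub_one_mul hb]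

/-- A bordered diagonal matrix whose diagonal is constant on the fibers of `b`: repeated diagonal
entries split off from the characteristic polynomial. -/
theorem Matrix.charpoly_fromBlocks_diagonal_comp {K : Type*} [Field K] [Infinite K] [DecidableEq ι]
    {b : ι → κ} (hb : Function.Surjective b) (d : κ → K) (v w : ι → K) (c : K) :
    (Matrix.fromBlocks (Matrix.diagonal fun l => d (b l)) (Matrix.of fun l (_ : Unit) => v l)
      (Matrix.of fun (_ : Unit) l => w l) (Matrix.of fun _ _ => c)).charpoly
      = ((X - C c) * ∏ j, (X - C (d j))
          - ∑ i, C (∑ l with b l = i, v l * w l) * ∏ j ∈ univ.erase i, (X - C (d j)))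
        * ∏ j, (X - C (d j)) ^ (#{l | b l = j} - 1) := by
  rw [Matrix.charpoly_fromBlocks_diagonal_unit,
    prod_comp_eq_prod_pow_card_sub_one_mul hb fun j => X - C (d j), sub_mul _ (∑ _, _), sum_mul,
    ← sum_fiberwise univ b]
  congr 1
  · ring
  refine sum_congr rfl fun i _ => ?_
  rw [map_sum, sum_mul, sum_mul]
  refine sum_congr rfl fun l hl => ?_
  rw [prod_erase_comp_eq_prod_pow_card_sub_one_mul hb (fun j => X_sub_C_ne_zero (d j)),
    (mem_filter.mp hl).2]
  ring

/-- Partial fraction identity: `∏ (X - μ i)` is determined by its values at the nodes `d i` and its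
two leading coefficients. -/
theorem Polynomial.sub_sum_eq_prod_X_sub_C_iff {K η : Type*} [Field K] [Fintype η] {d : κ → K}
    (hd : Function.Injective d) (μ : η → K) (hcard : Fintype.card η = Fintype.card κ + 1)
    (s : κ → K) :
    (X - C (∑ i, μ i - ∑ j, d j)) * ∏ j, (X - C (d j))
        - ∑ i, C (s i) * ∏ j ∈ univ.erase i, (X - C (d j)) = ∏ i, (X - C (μ i))
      ↔ ∀ i, s i = -(∏ j, (d i - μ j)) / ∏ j ∈ univ.erase i, (d i - d j) := by
  have hsum : ∀ i, (∑ i', C (s i') * ∏ j ∈ univ.erase i', (X - C (d j))).eval (d i)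
      = s i * ∏ j ∈ univ.erase i, (d i - d j) := by
    intro i
    simp only [eval_finsetSum, eval_mul, eval_C, eval_prod, eval_sub, eval_X]
    refine sum_eq_single_of_mem i (mem_univ i) fun j _ hj => ?_
    rw [prod_eq_zero (mem_erase.mpr ⟨hj.symm, mem_univ i⟩) (sub_self _), mul_zero]
  have hmonic : (∏ j, (X - C (d j))).Monic := monic_prod_X_sub_C _ _
  have hdeg : ((X - C (∑ i, μ i - ∑ j, d j)) * ∏ j, (X - C (d j)) - ∏ i, (X - C (μ i))).degree
      < (Fintype.card κ : WithBot ℕ) := by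
    refine degree_sub_lt_of_nextCoeff_eq ((monic_X_sub_C _).mul hmonic) (monic_prod_X_sub_C _ _)
      ?_ ?_ ?_
    · rw [(monic_X_sub_C _).natDegree_mul hmonic, natDegree_X_sub_C,
        natDegree_finsetProd_X_sub_C_eq_card, card_univ, add_comm]
    · rw [natDegree_finsetProd_X_sub_C_eq_card, card_univ, hcard]
    · rw [(monic_X_sub_C _).nextCoeff_mul hmonic, nextCoeff_X_sub_C, prod_X_sub_C_nextCoeff,
        prod_X_sub_C_nextCoeff]
      ring
  have hdeg' : (∑ i, C (s i) * ∏ j ∈ univ.erase i, (X - C (d j))).degree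
      < (Fintype.card κ : WithBot ℕ) := by
    refine (degree_sum_le _ _).trans_lt ((Finset.sup_lt_iff (WithBot.bot_lt_coe _)).mpr
      fun i _ => ?_)
    rw [← smul_eq_C_mul]
    refine ((degree_smul_le _ _).trans degree_le_natDegree).trans_lt ?_
    rw [natDegree_finsetProd_X_sub_C_eq_card, Nat.cast_lt]
    exact card_lt_card (erase_ssubset (mem_univ i))
  have hnode : ∀ i, ∏ j ∈ univ.erase i, (d i - d j) ≠ 0 := fun i =>
    prod_ne_zero_iff.mpr fun j hj => sub_ne_zero.mpr fun h => (mem_erase.mp hj).1 (hd h).symm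
  rw [sub_eq_iff_eq_add, ← sub_eq_iff_eq_add']
  have heval : ∀ i, ((X - C (∑ i, μ i - ∑ j, d j)) * ∏ j, (X - C (d j))
      - ∏ i, (X - C (μ i))).eval (d i) = -∏ j, (d i - μ j) := by
    intro i
    have hzero : ∏ j, (d i - d j) = 0 := prod_eq_zero (mem_univ i) (sub_self (d i))
    simp [eval_prod, hzero]
  constructor
  · intro h i
    rw [eq_div_iff (hnode i), ← hsum, ← h, heval]
  · intro h
    refine eq_of_degrees_lt_of_eval_index_eq univ hd.injOn hdeg hdeg' fun i _ => ?_
    rw [heval, hsum, h, div_mul_cancel₀ _ (hnode i)]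

end Fiber

/-- **Characterization of the bordered matrices with prescribed spectrum.**
Setup as in the Rayleigh fiber sampling step: `k ≥ 2`, `m ≥ 1`, `δ 0 > ⋯ > δ (m-1)`,
`blk : Fin (k-1) → Fin m` a monotone surjection with fibers of cardinalities `nᵢ`
(`n₀ + ⋯ + n_{m-1} = k - 1`), `D` the diagonal matrix with diagonal `δ ∘ blk`, and
`sᵢ(v)` the squared norm of the `i`-th block of `v ∈ ℂ^{k-1}`.
Let `μ 0 ≥ δ 0 ≥ μ 1 ≥ δ 1 ≥ ⋯ ≥ δ (m-1) ≥ μ m` be interlacing real numbers, set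
`c = Σᵢ μᵢ − Σⱼ δⱼ` and `rᵢ² = − ∏ⱼ (δᵢ − μⱼ) / ∏_{j ≠ i} (δᵢ − δⱼ)`.  Then
`M(v, c) = [[D, v], [v*, c]]` has characteristic polynomial
`det (t I − M(v,c)) = ∏ᵢ (t − μᵢ) · ∏ⱼ (t − δⱼ)^{nⱼ − 1}` if and only if `sᵢ(v) = rᵢ²`
for every `i`. -/
theorem charpoly_bordered_iff_block_norms (k m : ℕ) (hk : 2 ≤ k) (hm : 1 ≤ m)
    (δ : Fin m → ℝ) (hδ : StrictAnti δ)
    (blk : Fin (k - 1) → Fin m) (hmono : Monotone blk) (hsurj : Function.Surjective blk)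
    (μ : Fin (m + 1) → ℝ)
    (hint : ∀ i : Fin m, δ i ≤ μ i.castSucc ∧ μ i.succ ≤ δ i)
    (v : Fin (k - 1) → ℂ) :
    (borderedMatrix (fun l => δ (blk l)) v ((∑ i : Fin (m + 1), μ i) - ∑ j : Fin m, δ j)).charpoly
        = (∏ i : Fin (m + 1), (X - C ((μ i : ℝ) : ℂ))) *
            ∏ j : Fin m,
              (X - C ((δ j : ℝ) : ℂ)) ^ ((Finset.univ.filter fun l => blk l = j).card - 1)
      ↔ ∀ i : Fin m,
          (∑ l ∈ Finset.univ.filter fun l => blk l = i, Complex.normSq (v l))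
            = -(∏ j : Fin (m + 1), (δ i - μ j)) / ∏ j ∈ Finset.univ.erase i, (δ i - δ j) := by
  have hinj : Function.Injective fun i => (δ i : ℂ) := Complex.ofReal_injective.comp hδ.injective
  have hQ : (∏ j : Fin m, (X - C ((δ j : ℝ) : ℂ)) ^
      ((Finset.univ.filter fun l => blk l = j).card - 1)) ≠ 0 :=
    Finset.prod_ne_zero_iff.mpr fun j _ => pow_ne_zero _ (X_sub_C_ne_zero _)
  have key := Polynomial.sub_sum_eq_prod_X_sub_C_iff hinj (fun i => (μ i : ℂ)) (by simp)
    fun i => ∑ l with blk l = i, v l * (starRingEnd ℂ) (v l)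
  rw [borderedMatrix,
    Matrix.charpoly_fromBlocks_diagonal_comp hsurj fun j => (δ j : ℂ), mul_left_inj' hQ]
  push_cast
  rw [key]
  refine forall_congr' fun i => ?_
  simp only [Complex.mul_conj]
  norm_cast
end

section
/- Let X and Y be standard Borel spaces, π : Y → X a measurable map, and κ a Markov kernel from X to Y with κ(x)(π^{-1}{x}) = 1 for every x ∈ X. If μ and ν are probability measures on Y that both disintegrate through κ, then sup over measurable E ⊆ Y of |μ(E) − ν(E)| equals sup over measurable F ⊆ X of |(π_*μ)(F) − (π_*ν)(F)|; that is, the total variation distance between μ and ν equals the total variation distance between their pushforwards π_*μ and π_*ν. -/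
open MeasureTheory

open scoped ENNReal

/-- A measurable `[0, 1]`-valued function separates two finite measures no better than
some measurable set does. -/
theorem MeasureTheory.Measure.exists_measurableSet_lintegral_add_le
    {X : Type*} [MeasurableSpace X] (a b : Measure X) [IsFiniteMeasure a] [IsFiniteMeasure b]
    {f : X → ℝ≥0∞} (hf : Measurable f) (hf1 : ∀ x, f x ≤ 1) :
    ∃ S, MeasurableSet S ∧ ∫⁻ x, f x ∂a + b S ≤ ∫⁻ x, f x ∂b + a S := by
  obtain ⟨S, hS, hba, hab⟩ := exists_isHahnDecomposition b a
  refine ⟨S, hS, ?_⟩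
  have split (m : Measure X) : m S = ∫⁻ x in S, f x ∂m + ∫⁻ x in S, (1 - f x) ∂m := by
    rw [← lintegral_add_left hf]
    simp [add_tsub_cancel_of_le (hf1 _)]
  rw [← lintegral_add_compl f hS (μ := a), ← lintegral_add_compl f hS (μ := b), split a, split b]
  have on_compl : ∫⁻ x in Sᶜ, f x ∂a ≤ ∫⁻ x in Sᶜ, f x ∂b := lintegral_mono' hab le_rfl
  have on_set : ∫⁻ x in S, (1 - f x) ∂b ≤ ∫⁻ x in S, (1 - f x) ∂a := lintegral_mono' hba le_rfl
  calc
    _ = (∫⁻ x in S, f x ∂a + ∫⁻ x in S, f x ∂b)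
        + (∫⁻ x in Sᶜ, f x ∂a + ∫⁻ x in S, (1 - f x) ∂b) := by ring
    _ ≤ (∫⁻ x in S, f x ∂a + ∫⁻ x in S, f x ∂b)
        + (∫⁻ x in Sᶜ, f x ∂b + ∫⁻ x in S, (1 - f x) ∂a) := by gcongr
    _ = _ := by ring

/-- Averaging a Markov kernel against two finite measures does not increase the difference of
masses beyond that attained on some measurable set of the base. -/
theorem MeasureTheory.Measure.exists_measurableSet_sub_le_of_eq_lintegral
    {X Y : Type*} [MeasurableSpace X] [MeasurableSpace Y]
    (κ : ProbabilityTheory.Kernel X Y) [ProbabilityTheory.IsMarkovKernel κ]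
    (a b : Measure X) [IsFiniteMeasure a] [IsFiniteMeasure b]
    (μ ν : Measure Y) [IsFiniteMeasure μ] [IsFiniteMeasure ν] {E : Set Y} (hE : MeasurableSet E)
    (hμ : μ E = ∫⁻ x, κ x E ∂a) (hν : ν E = ∫⁻ x, κ x E ∂b) :
    ∃ S, MeasurableSet S ∧ (μ E).toReal - (ν E).toReal ≤ (a S).toReal - (b S).toReal := by
  obtain ⟨S, hS, h⟩ := a.exists_measurableSet_lintegral_add_le b (κ.measurable_coe hE)
    fun _ ↦ prob_le_one
  refine ⟨S, hS, ?_⟩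
  rw [← hμ, ← hν] at h
  have h' := ENNReal.toReal_mono (by finiteness) h
  rw [ENNReal.toReal_add (by finiteness) (by finiteness),
    ENNReal.toReal_add (by finiteness) (by finiteness)] at h'
  linarith

/-- The defining family of the total variation distance of two probability measures is bounded. -/
theorem MeasureTheory.Measure.bddAbove_range_iSup_abs_sub
    {X : Type*} [MeasurableSpace X] (a b : Measure X)
    [IsProbabilityMeasure a] [IsProbabilityMeasure b] :
    BddAbove (Set.range fun S : Set X ↦
      ⨆ _ : MeasurableSet S, |(a S).toReal - (b S).toReal|) := by
  refine ⟨1, ?_⟩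
  rintro _ ⟨S, rfl⟩
  refine Real.iSup_le (fun _ ↦ ?_) zero_le_one
  have ha : (a S).toReal ≤ 1 := measureReal_le_one
  have hb : (b S).toReal ≤ 1 := measureReal_le_one
  have ha0 : 0 ≤ (a S).toReal := ENNReal.toReal_nonneg
  have hb0 : 0 ≤ (b S).toReal := ENNReal.toReal_nonneg
  exact abs_le.2 ⟨by linarith, by linarith⟩

theorem MeasureTheory.Measure.abs_sub_le_iSup_abs_sub
    {X : Type*} [MeasurableSpace X] (a b : Measure X)
    [IsProbabilityMeasure a] [IsProbabilityMeasure b] {S : Set X} (hS : MeasurableSet S) :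
    |(a S).toReal - (b S).toReal| ≤
      ⨆ (S : Set X) (_ : MeasurableSet S), |(a S).toReal - (b S).toReal| := by
  have h := le_ciSup (a.bddAbove_range_iSup_abs_sub b) S
  rwa [ciSup_pos hS] at h

/-- **Total variation distance is preserved under disintegration through a common kernel.**
Let `X` and `Y` be standard Borel spaces, `π : Y → X` measurable, and `κ` a Markov kernel
from `X` to `Y` with `κ x (π⁻¹ {x}) = 1` for every `x`.  If `μ` and `ν` are probability
measures on `Y` that both disintegrate through `κ` (i.e. `μ E = ∫ κ x E d(π_*μ)(x)` for all
measurable `E`, and likewise for `ν`), then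
`sup_E |μ E − ν E| = sup_F |π_*μ F − π_*ν F|`, i.e. the total variation distance between `μ`
and `ν` equals that between their pushforwards. -/
theorem tv_dist_eq_tv_dist_pushforward
    {X Y : Type*} [MeasurableSpace X] [StandardBorelSpace X]
    [MeasurableSpace Y] [StandardBorelSpace Y]
    (π : Y → X) (hπ : Measurable π)
    (κ : ProbabilityTheory.Kernel X Y) [ProbabilityTheory.IsMarkovKernel κ]
    (hκ : ∀ x : X, κ x (π ⁻¹' {x}) = 1)
    (μ ν : Measure Y) [IsProbabilityMeasure μ] [IsProbabilityMeasure ν]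
    (hμ : ∀ E : Set Y, MeasurableSet E → μ E = ∫⁻ x, κ x E ∂(μ.map π))
    (hν : ∀ E : Set Y, MeasurableSet E → ν E = ∫⁻ x, κ x E ∂(ν.map π)) :
    (⨆ (E : Set Y) (_ : MeasurableSet E), |(μ E).toReal - (ν E).toReal|)
      = ⨆ (F : Set X) (_ : MeasurableSet F), |((μ.map π) F).toReal - ((ν.map π) F).toReal| := by
  have := Measure.isProbabilityMeasure_map (μ := μ) hπ.aemeasurable
  have := Measure.isProbabilityMeasure_map (μ := ν) hπ.aemeasurable
  apply le_antisymm
  · have sup_nonneg : 0 ≤ ⨆ (F : Set X) (_ : MeasurableSet F),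
        |((μ.map π) F).toReal - ((ν.map π) F).toReal| :=
      Real.iSup_nonneg fun _ ↦ Real.iSup_nonneg fun _ ↦ abs_nonneg _
    refine Real.iSup_le (fun E ↦ Real.iSup_le (fun hE ↦ abs_sub_le_iff.2 ⟨?_, ?_⟩) sup_nonneg)
      sup_nonneg
    · obtain ⟨S, hS, h⟩ := Measure.exists_measurableSet_sub_le_of_eq_lintegral κ
        (μ.map π) (ν.map π) μ ν hE (hμ E hE) (hν E hE)
      exact h.trans ((le_abs_self _).trans (Measure.abs_sub_le_iSup_abs_sub _ _ hS))
    · obtain ⟨S, hS, h⟩ := Measure.exists_measurableSet_sub_le_of_eq_lintegral κ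
        (ν.map π) (μ.map π) ν μ hE (hν E hE) (hμ E hE)
      refine h.trans ((le_abs_self _).trans ?_)
      rw [abs_sub_comm]
      exact Measure.abs_sub_le_iSup_abs_sub _ _ hS
  · have sup_nonneg : 0 ≤ ⨆ (E : Set Y) (_ : MeasurableSet E), |(μ E).toReal - (ν E).toReal| :=
      Real.iSup_nonneg fun _ ↦ Real.iSup_nonneg fun _ ↦ abs_nonneg _
    refine Real.iSup_le (fun F ↦ Real.iSup_le (fun hF ↦ ?_) sup_nonneg) sup_nonneg
    rw [Measure.map_apply hπ hF, Measure.map_apply hπ hF]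
    exact Measure.abs_sub_le_iSup_abs_sub μ ν (hπ hF)
end

section
/- Let X and Y be standard Borel spaces, π : Y → X a measurable map, and κ a Markov kernel from X to Y with κ(x)(π^{-1}{x}) = 1 for every x ∈ X. Let μ and ν be probability measures on Y that both disintegrate through κ, and assume μ is absolutely continuous with respect to ν. Then π_*μ is absolutely continuous with respect to π_*ν, and for every α ∈ (0, ∞) with α ≠ 1, ∫_Y (dμ/dν)^α dν = ∫_X (d(π_*μ)/d(π_*ν))^α d(π_*ν), where dμ/dν and d(π_*μ)/d(π_*ν) denote Radon–Nikodym derivatives; consequently the α-divergence D_α(μ ∥ ν) = (α−1)^{-1} log ∫ (dμ/dν)^α dν equals D_α(π_*μ ∥ π_*ν). -/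
open MeasureTheory ProbabilityTheory

lemma eq_bind_of_forall_measurableSet {X Y : Type*} [MeasurableSpace X] [MeasurableSpace Y]
    {κ : Kernel X Y} {μ : Measure Y} {ρ : Measure X}
    (h : ∀ E : Set Y, MeasurableSet E → μ E = ∫⁻ x, κ x E ∂ρ) :
    μ = ρ.bind κ := by
  ext E hE
  rw [Measure.bind_apply hE κ.aemeasurable, h E hE]

/-- Reweighting the mixture `ρ.bind κ` by a function of `π` amounts to reweighting the mixing
measure `ρ`, when each `κ x` is concentrated on the fibre of `π` over `x`. -/
lemma bind_withDensity_comp {X Y : Type*} [MeasurableSpace X] [MeasurableSpace Y]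
    {π : Y → X} (hπ : Measurable π) {κ : Kernel X Y} (hκ : ∀ x, ∀ᵐ y ∂(κ x), π y = x)
    (ρ : Measure X) {g : X → ENNReal} (hg : Measurable g) :
    (ρ.bind κ).withDensity (g ∘ π) = (ρ.withDensity g).bind κ := by
  ext E hE
  have hgπ : Measurable (E.indicator (g ∘ π)) := (hg.comp hπ).indicator hE
  rw [withDensity_apply _ hE, ← lintegral_indicator hE,
    Measure.lintegral_bind κ.aemeasurable hgπ.aemeasurable,
    Measure.bind_apply hE κ.aemeasurable,
    lintegral_withDensity_eq_lintegral_mul _ hg (κ.measurable_coe hE)]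
  refine lintegral_congr fun x ↦ ?_
  calc ∫⁻ y, E.indicator (g ∘ π) y ∂(κ x)
      = ∫⁻ y, E.indicator (fun _ ↦ g x) y ∂(κ x) := by
        refine lintegral_congr_ae ?_
        filter_upwards [hκ x] with y hy
        simp only [Set.indicator, Function.comp_apply, hy]
    _ = g x * κ x E := lintegral_indicator_const hE _

/-- If two measures disintegrate through the same kernel, then their Radon-Nikodym derivative
factors through the base. -/
lemma rnDeriv_eq_rnDeriv_map_comp {X Y : Type*} [MeasurableSpace X] [MeasurableSingletonClass X]
    [MeasurableSpace Y] {π : Y → X} (hπ : Measurable π) {κ : Kernel X Y} [IsMarkovKernel κ]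
    (hκ : ∀ x, κ x (π ⁻¹' {x}) = 1) {μ ν : Measure Y} [IsFiniteMeasure μ] [IsFiniteMeasure ν]
    (hμ : μ = (μ.map π).bind κ) (hν : ν = (ν.map π).bind κ) (hac : μ.map π ≪ ν.map π) :
    μ.rnDeriv ν =ᵐ[ν] (μ.map π).rnDeriv (ν.map π) ∘ π := by
  have hκ' : ∀ x, ∀ᵐ y ∂(κ x), π y = x := fun x ↦
    (prob_compl_eq_zero_iff (hπ (measurableSet_singleton x))).2 (hκ x)
  have hg := Measure.measurable_rnDeriv (μ.map π) (ν.map π)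
  have h : μ = ν.withDensity ((μ.map π).rnDeriv (ν.map π) ∘ π) := by
    have h_bind := bind_withDensity_comp hπ hκ' (ν.map π) hg
    rwa [Measure.withDensity_rnDeriv_eq _ _ hac, ← hμ, ← hν, eq_comm] at h_bind
  have h_deriv := Measure.rnDeriv_withDensity ν (hg.comp hπ)
  rwa [← h] at h_deriv

/-- **α-divergence is preserved under disintegration through a common kernel.**
Let `X` and `Y` be standard Borel spaces, `π : Y → X` measurable, and `κ` a Markov kernel
from `X` to `Y` with `κ x (π⁻¹ {x}) = 1` for every `x`.  Let `μ` and `ν` be probability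
measures on `Y` that both disintegrate through `κ`, with `μ ≪ ν`.  Then `π_*μ ≪ π_*ν`, and
for every `α ∈ (0, ∞)` with `α ≠ 1`,
`∫ (dμ/dν)^α dν = ∫ (d(π_*μ)/d(π_*ν))^α d(π_*ν)`; consequently the α-divergence
`D_α(μ ∥ ν) = (α − 1)⁻¹ log ∫ (dμ/dν)^α dν` equals `D_α(π_*μ ∥ π_*ν)`. -/
theorem alpha_divergence_eq_alpha_divergence_pushforward
    {X Y : Type*} [MeasurableSpace X] [StandardBorelSpace X]
    [MeasurableSpace Y] [StandardBorelSpace Y]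
    (π : Y → X) (hπ : Measurable π)
    (κ : ProbabilityTheory.Kernel X Y) [ProbabilityTheory.IsMarkovKernel κ]
    (hκ : ∀ x : X, κ x (π ⁻¹' {x}) = 1)
    (μ ν : Measure Y) [IsProbabilityMeasure μ] [IsProbabilityMeasure ν]
    (hμ : ∀ E : Set Y, MeasurableSet E → μ E = ∫⁻ x, κ x E ∂(μ.map π))
    (hν : ∀ E : Set Y, MeasurableSet E → ν E = ∫⁻ x, κ x E ∂(ν.map π))
    (hac : μ ≪ ν) :
    (μ.map π) ≪ (ν.map π) ∧
      ∀ α : ℝ, 0 < α → α ≠ 1 →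
        (∫⁻ y, (μ.rnDeriv ν y) ^ α ∂ν
            = ∫⁻ x, ((μ.map π).rnDeriv (ν.map π) x) ^ α ∂(ν.map π)) ∧
        (α - 1)⁻¹ * Real.log ((∫⁻ y, (μ.rnDeriv ν y) ^ α ∂ν).toReal)
            = (α - 1)⁻¹ *
                Real.log ((∫⁻ x, ((μ.map π).rnDeriv (ν.map π) x) ^ α ∂(ν.map π)).toReal) := by
  have hac' : μ.map π ≪ ν.map π := hac.map hπ
  refine ⟨hac', fun α _ _ ↦ ?_⟩
  have h_int : ∫⁻ y, (μ.rnDeriv ν y) ^ α ∂ν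
      = ∫⁻ x, ((μ.map π).rnDeriv (ν.map π) x) ^ α ∂(ν.map π) := by
    rw [lintegral_map (by fun_prop) hπ]
    refine lintegral_congr_ae ?_
    filter_upwards [rnDeriv_eq_rnDeriv_map_comp hπ hκ (eq_bind_of_forall_measurableSet hμ)
      (eq_bind_of_forall_measurableSet hν) hac'] with y hy
    rw [hy, Function.comp_apply]
  exact ⟨h_int, by rw [h_int]⟩
end

section
/- Let X and Y be standard Borel spaces, π : Y → X a measurable map, and κ a Markov kernel from X to Y with κ(x)(π^{-1}{x}) = 1 for every x ∈ X. Let μ and ν be probability measures on Y that both disintegrate through κ, and assume μ is absolutely continuous with respect to ν. Then the ν-essential supremum of the Radon–Nikodym derivative dμ/dν equals the (π_*ν)-essential supremum of d(π_*μ)/d(π_*ν); that is, the infinity divergence D_∞(μ ∥ ν) equals D_∞(π_*μ ∥ π_*ν). -/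
open MeasureTheory

open scoped ENNReal

/-- If `κ x` is concentrated on the fibre `π ⁻¹' {x}` for every `x`, then weighting `m.bind κ` by
`f ∘ π` amounts to weighting `m` by `f`. -/
theorem withDensity_comp_bind_of_fibre {X Y : Type*} [MeasurableSpace X]
    [MeasurableSingletonClass X] [MeasurableSpace Y] {π : Y → X} (hπ : Measurable π)
    (κ : ProbabilityTheory.Kernel X Y) [ProbabilityTheory.IsMarkovKernel κ]
    (hκ : ∀ x : X, κ x (π ⁻¹' {x}) = 1) (m : Measure X) {f : X → ℝ≥0∞} (hf : Measurable f) :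
    (m.bind κ).withDensity (fun y => f (π y)) = (m.withDensity f).bind κ := by
  ext E hE
  have hfπ : Measurable fun y => f (π y) := hf.comp hπ
  rw [withDensity_apply _ hE, ← lintegral_indicator hE,
    Measure.lintegral_bind κ.measurable.aemeasurable (hfπ.indicator hE).aemeasurable,
    Measure.bind_apply hE κ.measurable.aemeasurable,
    lintegral_withDensity_eq_lintegral_mul _ hf (κ.measurable_coe hE)]
  refine lintegral_congr fun x => ?_
  have hfib : ∀ᵐ y ∂(κ x), π y = x :=
    (mem_ae_iff_prob_eq_one (hπ (measurableSet_singleton x))).2 (hκ x)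
  rw [lintegral_indicator hE, Pi.mul_apply, ← setLIntegral_const]
  refine lintegral_congr_ae (ae_restrict_of_ae ?_)
  filter_upwards [hfib] with y hy
  rw [hy]

/-- **Infinity divergence is preserved under disintegration through a common kernel.**
Let `X` and `Y` be standard Borel spaces, `π : Y → X` measurable, and `κ` a Markov kernel
from `X` to `Y` with `κ x (π⁻¹ {x}) = 1` for every `x`.  Let `μ` and `ν` be probability
measures on `Y` that both disintegrate through `κ`, with `μ ≪ ν`.  Then the `ν`-essential
supremum of `dμ/dν` equals the `π_*ν`-essential supremum of `d(π_*μ)/d(π_*ν)`; that is,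
`D_∞(μ ∥ ν) = D_∞(π_*μ ∥ π_*ν)`. -/
theorem infinity_divergence_eq_infinity_divergence_pushforward
    {X Y : Type*} [MeasurableSpace X] [StandardBorelSpace X]
    [MeasurableSpace Y] [StandardBorelSpace Y]
    (π : Y → X) (hπ : Measurable π)
    (κ : ProbabilityTheory.Kernel X Y) [ProbabilityTheory.IsMarkovKernel κ]
    (hκ : ∀ x : X, κ x (π ⁻¹' {x}) = 1)
    (μ ν : Measure Y) [IsProbabilityMeasure μ] [IsProbabilityMeasure ν]
    (hμ : ∀ E : Set Y, MeasurableSet E → μ E = ∫⁻ x, κ x E ∂(μ.map π))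
    (hν : ∀ E : Set Y, MeasurableSet E → ν E = ∫⁻ x, κ x E ∂(ν.map π))
    (hac : μ ≪ ν) :
    essSup (fun y => μ.rnDeriv ν y) ν
      = essSup (fun x => (μ.map π).rnDeriv (ν.map π) x) (ν.map π) := by
  have hμκ : (μ.map π).bind κ = μ := by
    ext E hE
    rw [Measure.bind_apply hE κ.measurable.aemeasurable, ← hμ E hE]
  have hνκ : (ν.map π).bind κ = ν := by
    ext E hE
    rw [Measure.bind_apply hE κ.measurable.aemeasurable, ← hν E hE]
  have hf : Measurable ((μ.map π).rnDeriv (ν.map π)) := Measure.measurable_rnDeriv _ _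
  have hdens : ν.withDensity (fun y => (μ.map π).rnDeriv (ν.map π) (π y)) = μ := by
    have h := withDensity_comp_bind_of_fibre hπ κ hκ (ν.map π) hf
    rwa [Measure.withDensity_rnDeriv_eq _ _ (hac.map hπ), hμκ, hνκ] at h
  have hae : μ.rnDeriv ν =ᵐ[ν] (μ.map π).rnDeriv (ν.map π) ∘ π := by
    have h := Measure.rnDeriv_withDensity ν (hf.comp hπ)
    rwa [show ν.withDensity ((μ.map π).rnDeriv (ν.map π) ∘ π) = μ from hdens] at h
  exact (essSup_congr_ae hae).trans (essSup_map_measure hf.aemeasurable hπ.aemeasurable).symm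
end
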